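/- Converse disintegration inequality: with the same notation, W_{c̃}(P_{Z,X}, Q_{Z,X}) ≥ ∫_Z W_{c_X}(P_{X|Z=z}, Q_{X|Z=z}) P_Z(dz); hence the two quantities are equal, and the joint OT cost with the diagonal-restricted cost c̃ equals the averaged conditional OT cost. -/

import Mathlib

open MeasureTheory ProbabilityTheory
open scoped ENNReal Classical

/-- The optimal transport cost `W_c(μ, ν)`: the infimum, over couplings `π` of `μ` and `ν`,
of `∫ c dπ`. -/
noncomputable def otCost {α β : Type*} [MeasurableSpace α] [MeasurableSpace β]
    (c : α → β → ℝ≥0∞) (μ : Measure α) (ν : Measure β) : ℝ≥0∞ :=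
  ⨅ π ∈ {π : Measure (α × β) | π.map Prod.fst = μ ∧ π.map Prod.snd = ν},
    ∫⁻ p, c p.1 p.2 ∂π


open scoped NNReal Topology
open Filter

/-- Measurable selection from a finite (encodable) type. -/
lemma aux_select {Z D : Type*} [MeasurableSpace Z] [Countable D] [MeasurableSpace D]
    (P : Z → D → Prop) (hP : ∀ d, MeasurableSet {z | P z d}) (hex : ∀ z, ∃ d, P z d) :
    ∃ s : Z → D, Measurable s ∧ ∀ z, P z (s z) := by
  rcases isEmpty_or_nonempty Z with hZ | ⟨⟨z0⟩⟩
  · exact ⟨fun z => (hZ.false z).elim, measurable_of_empty _, fun z => (hZ.false z).elim⟩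
  obtain ⟨d0, -⟩ := hex z0
  have : Nonempty D := ⟨d0⟩
  obtain ⟨e, he⟩ := exists_surjective_nat D
  have hex' : ∀ z, ∃ n, P z (e n) := fun z => by
    obtain ⟨d, hd⟩ := hex z
    obtain ⟨n, rfl⟩ := he d
    exact ⟨n, hd⟩
  refine ⟨fun z => e (Nat.find (hex' z)), ?_, fun z => Nat.find_spec (hex' z)⟩
  have := measurable_find (p := fun z n => P z (e n)) hex' (fun n => hP (e n))
  exact (measurable_from_nat (f := e)).comp this

/-- A lower semicontinuous function on a product is a countable supremum of rectangles. -/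
lemma aux_lsc {X : Type*} [TopologicalSpace X] [SecondCountableTopology X]
    (c : X → X → ℝ≥0∞) (hc : LowerSemicontinuous fun p : X × X => c p.1 p.2) :
    ∃ (a : ℕ → ℝ≥0) (U V : ℕ → Set X), (∀ k, IsOpen (U k)) ∧ (∀ k, IsOpen (V k)) ∧
      ∀ x x', c x x' = ⨆ k, (if x ∈ U k ∧ x' ∈ V k then (a k : ℝ≥0∞) else 0) := by
  have hb := TopologicalSpace.isBasis_countableBasis X
  have hcount := TopologicalSpace.countable_countableBasis X
  let I := ℚ × TopologicalSpace.countableBasis X × TopologicalSpace.countableBasis X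
  have : Countable (TopologicalSpace.countableBasis X) := hcount
  rcases isEmpty_or_nonempty (TopologicalSpace.countableBasis X) with hE | hN
  · refine ⟨fun _ => 0, fun _ => ∅, fun _ => ∅, by simp, by simp, fun x => ?_⟩
    obtain ⟨v, hv, -⟩ := hb.exists_subset_of_mem_open (Set.mem_univ x) isOpen_univ
    exact (hE.false ⟨v, hv⟩).elim
  obtain ⟨e, he⟩ := exists_surjective_nat I
  refine ⟨fun k => if ∀ x ∈ ((e k).2.1 : Set X), ∀ x' ∈ ((e k).2.2 : Set X),
      (Real.toNNReal (e k).1 : ℝ≥0∞) ≤ c x x' then Real.toNNReal (e k).1 else 0,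
    fun k => (e k).2.1, fun k => (e k).2.2, fun k => hb.isOpen (e k).2.1.2,
    fun k => hb.isOpen (e k).2.2.2, fun x x' => le_antisymm ?_ ?_⟩
  · refine le_of_forall_lt fun b hb' => ?_
    obtain ⟨q, hq0, hbq, hqc⟩ := ENNReal.lt_iff_exists_rat_btwn.1 hb'
    have hop := hc.isOpen_preimage (Real.toNNReal q : ℝ≥0∞)
    obtain ⟨A, hA, B, hB, hxA, hxB⟩ :
        ∃ A ∈ TopologicalSpace.countableBasis X, ∃ B ∈ TopologicalSpace.countableBasis X,
        (x ∈ A ∧ x' ∈ B) ∧ A ×ˢ B ⊆ (fun p : X × X => c p.1 p.2) ⁻¹'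
          Set.Ioi (Real.toNNReal q : ℝ≥0∞) := by
      obtain ⟨v, hv, hxv, hsub⟩ := (hb.prod hb).exists_subset_of_mem_open
        (show (x, x') ∈ _ from hqc) hop
      obtain ⟨A, hA, B, hB, rfl⟩ := hv
      exact ⟨A, hA, B, hB, hxv, hsub⟩
    obtain ⟨k, hk⟩ := he (q, ⟨A, hA⟩, ⟨B, hB⟩)
    refine lt_of_lt_of_le hbq (le_iSup_of_le k ?_)
    simp only [hk]
    rw [if_pos hxA, if_pos]
    intro y hy y' hy'
    exact le_of_lt (hxB (show (y, y') ∈ A ×ˢ B from ⟨hy, hy'⟩))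
  · refine iSup_le fun k => ?_
    by_cases h1 : x ∈ ((e k).2.1 : Set X) ∧ x' ∈ ((e k).2.2 : Set X)
    · rw [if_pos h1]
      by_cases h2 : ∀ x ∈ ((e k).2.1 : Set X), ∀ x' ∈ ((e k).2.2 : Set X),
        (Real.toNNReal (e k).1 : ℝ≥0∞) ≤ c x x'
      · beta_reduce
        rw [if_pos h2]
        exact h2 x h1.1 x' h1.2
      · beta_reduce
        rw [if_neg h2]
        simp
    · rw [if_neg h1]
      simp

lemma aux_liminf {Ω : Type*} [MeasurableSpace Ω] [TopologicalSpace Ω] [OpensMeasurableSpace Ω]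
    {μ : Measure Ω} {μs : ℕ → Measure Ω} {f : Ω → ℝ} (hf : LowerSemicontinuous f) (f_nn : 0 ≤ f)
    (h_opens : ∀ G, IsOpen G → μ G ≤ atTop.liminf (fun i ↦ μs i G)) :
    ∫⁻ x, ENNReal.ofReal (f x) ∂μ ≤ atTop.liminf (fun i ↦ ∫⁻ x, ENNReal.ofReal (f x) ∂(μs i)) := by
  simp_rw [lintegral_eq_lintegral_meas_lt _ (Eventually.of_forall f_nn) hf.measurable.aemeasurable]
  calc ∫⁻ (t : ℝ) in Set.Ioi 0, μ {a | t < f a}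
      ≤ ∫⁻ (t : ℝ) in Set.Ioi 0, atTop.liminf (fun i ↦ (μs i) {a | t < f a}) :=
        lintegral_mono (fun t ↦ h_opens _ (hf.isOpen_preimage t))
    _ ≤ atTop.liminf (fun i ↦ ∫⁻ (t : ℝ) in Set.Ioi 0, (μs i) {a | t < f a}) :=
        lintegral_liminf_le (fun n ↦ Antitone.measurable (fun s t hst ↦
            measure_mono (fun ω hω ↦ lt_of_le_of_lt hst hω)))

lemma aux_compact {Z X : Type*}
    [MeasurableSpace Z] [TopologicalSpace Z] [PolishSpace Z] [BorelSpace Z]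
    [MeasurableSpace X] [TopologicalSpace X] [PolishSpace X] [BorelSpace X]
    (P Q : Measure (Z × X)) [IsProbabilityMeasure P] [IsProbabilityMeasure Q]
    (ρ : ℕ → Measure (Z × X × X))
    (h1 : ∀ n, (ρ n).map (fun w => (w.1, w.2.1)) = P)
    (h2 : ∀ n, (ρ n).map (fun w => (w.1, w.2.2)) = Q) :
    ∃ (μ : Measure (Z × X × X)) (φ : ℕ → ℕ), StrictMono φ ∧
      μ.map (fun w => (w.1, w.2.1)) = P ∧ μ.map (fun w => (w.1, w.2.2)) = Q ∧
      ∀ G, IsOpen G → μ G ≤ atTop.liminf (fun i ↦ ρ (φ i) G) := by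
  have hm1 : Continuous (fun w : Z × X × X => (w.1, w.2.1)) := by fun_prop
  have hm2 : Continuous (fun w : Z × X × X => (w.1, w.2.2)) := by fun_prop
  have hprob : ∀ n, IsProbabilityMeasure (ρ n) := fun n => by
    constructor
    have := congrArg (fun m => m Set.univ) (h1 n)
    simpa [Measure.map_apply hm1.measurable MeasurableSet.univ] using this
  let R : ℕ → ProbabilityMeasure (Z × X × X) := fun n => ⟨ρ n, hprob n⟩
  have hf1 : ∀ n, (ρ n).fst = P.fst := fun n => by
    rw [← h1 n, Measure.fst, Measure.fst, Measure.map_map measurable_fst hm1.measurable]; rfl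
  have hf2 : ∀ n, (ρ n).snd.fst = P.snd := fun n => by
    rw [← h1 n, Measure.fst, Measure.snd, Measure.snd, Measure.map_map measurable_snd hm1.measurable,
      Measure.map_map measurable_fst measurable_snd]; rfl
  have hf3 : ∀ n, (ρ n).snd.snd = Q.snd := fun n => by
    rw [← h2 n, Measure.snd, Measure.snd, Measure.snd, Measure.map_map measurable_snd hm2.measurable,
      Measure.map_map measurable_snd measurable_snd]; rfl
  have htight : IsTightMeasureSet (Set.range ρ) := by
    refine IsTightMeasureSet.prodMk ?_ (IsTightMeasureSet.prodMk ?_ ?_)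
    · refine (isTightMeasureSet_singleton (μ := P.fst)).subset ?_
      rintro _ ⟨_, ⟨n, rfl⟩, rfl⟩
      exact hf1 n
    · refine (isTightMeasureSet_singleton (μ := P.snd)).subset ?_
      rintro _ ⟨_, ⟨_, ⟨n, rfl⟩, rfl⟩, rfl⟩
      exact hf2 n
    · refine (isTightMeasureSet_singleton (μ := Q.snd)).subset ?_
      rintro _ ⟨_, ⟨_, ⟨n, rfl⟩, rfl⟩, rfl⟩
      exact hf3 n
  have hcomp : IsCompact (closure (Set.range R)) := by
    apply isCompact_closure_of_isTightMeasureSet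
    refine htight.subset ?_
    rintro _ ⟨_, ⟨n, rfl⟩, rfl⟩
    exact ⟨n, rfl⟩
  obtain ⟨μ, -, φ, hφ, hlim⟩ := hcomp.tendsto_subseq (x := R)
    (fun n => subset_closure ⟨n, rfl⟩)
  refine ⟨μ, φ, hφ, ?_, ?_, fun G hG =>
    ProbabilityMeasure.le_liminf_measure_open_of_tendsto hlim hG⟩
  · have ht := ProbabilityMeasure.tendsto_map_of_tendsto_of_continuous _ _ hlim hm1
    have hc : (fun i => ((R ∘ φ) i).map hm1.measurable.aemeasurable)
        = fun _ => (⟨P, inferInstance⟩ : ProbabilityMeasure (Z × X)) := by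
      funext i
      exact Subtype.ext (h1 (φ i))
    rw [hc] at ht
    have := tendsto_nhds_unique ht tendsto_const_nhds
    exact congrArg Subtype.val this
  · have ht := ProbabilityMeasure.tendsto_map_of_tendsto_of_continuous _ _ hlim hm2
    have hc : (fun i => ((R ∘ φ) i).map hm2.measurable.aemeasurable)
        = fun _ => (⟨Q, inferInstance⟩ : ProbabilityMeasure (Z × X)) := by
      funext i
      exact Subtype.ext (h2 (φ i))
    rw [hc] at ht
    have := tendsto_nhds_unique ht tendsto_const_nhds
    exact congrArg Subtype.val this

lemma aux_complete {F : Type*} [Fintype F] (p q : F → ℝ≥0∞) (hp1 : ∑ i, p i = 1)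
    (hq1 : ∑ j, q j = 1) (t : F → F → ℝ≥0∞) (h1 : ∀ i, ∑ j, t i j ≤ p i)
    (h2 : ∀ j, ∑ i, t i j ≤ q j) (c : F → F → ℝ≥0∞) (C : ℝ≥0∞) (hC : ∀ i j, c i j ≤ C)
    (η : F → F → ℝ≥0∞)
    (hη : ∀ i j, η i j = t i j + (p i - ∑ j, t i j) * (q j - ∑ i, t i j) / (1 - ∑ i, ∑ j, t i j)) :
    (∀ i, ∑ j, η i j = p i) ∧ (∀ j, ∑ i, η i j = q j) ∧
      ∑ i, ∑ j, c i j * η i j ≤ ∑ i, ∑ j, c i j * t i j + C * (1 - ∑ i, ∑ j, t i j) := by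
  set m := 1 - ∑ i, ∑ j, t i j with hm
  have hle : ∑ i, ∑ j, t i j ≤ 1 := hp1 ▸ Finset.sum_le_sum fun i _ => h1 i
  have hfin : ∑ i, ∑ j, t i j ≠ ⊤ := ne_top_of_le_ne_top ENNReal.one_ne_top hle
  have hmt : m ≠ ⊤ := ne_top_of_le_ne_top ENNReal.one_ne_top tsub_le_self
  have hR : ∑ i, (p i - ∑ j, t i j) = m := by
    rw [hm]
    refine ENNReal.eq_sub_of_add_eq hfin ?_
    rw [← Finset.sum_add_distrib, ← hp1]
    exact Finset.sum_congr rfl fun i _ => tsub_add_cancel_of_le (h1 i)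
  have hS : ∑ j, (q j - ∑ i, t i j) = m := by
    rw [hm]
    refine ENNReal.eq_sub_of_add_eq hfin ?_
    rw [Finset.sum_comm, ← Finset.sum_add_distrib, ← hq1]
    exact Finset.sum_congr rfl fun i _ => tsub_add_cancel_of_le (h2 i)
  have hRS : ∀ i, ∑ j, (p i - ∑ j, t i j) * (q j - ∑ i, t i j) / m = p i - ∑ j, t i j := by
    intro i
    simp_rw [div_eq_mul_inv]
    rw [← Finset.sum_mul, ← Finset.mul_sum, hS, mul_assoc]
    by_cases h0 : m = 0
    · have : p i - ∑ j, t i j = 0 := by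
        have := hR.trans h0
        exact (Finset.sum_eq_zero_iff.1 this) i (Finset.mem_univ _)
      rw [this, zero_mul]
    · rw [ENNReal.mul_inv_cancel h0 hmt, mul_one]
  have hSR : ∀ j, ∑ i, (p i - ∑ j, t i j) * (q j - ∑ i, t i j) / m = q j - ∑ i, t i j := by
    intro j
    simp_rw [div_eq_mul_inv]
    rw [← Finset.sum_mul, ← Finset.sum_mul, hR, mul_comm m, mul_assoc]
    by_cases h0 : m = 0
    · have : q j - ∑ i, t i j = 0 := by
        have := hS.trans h0
        exact (Finset.sum_eq_zero_iff.1 this) j (Finset.mem_univ _)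
      rw [this, zero_mul]
    · rw [ENNReal.mul_inv_cancel h0 hmt, mul_one]
  refine ⟨fun i => ?_, fun j => ?_, ?_⟩
  · simp_rw [hη]
    rw [Finset.sum_add_distrib, hRS i, add_tsub_cancel_of_le (h1 i)]
  · simp_rw [hη]
    rw [Finset.sum_add_distrib, hSR j, add_tsub_cancel_of_le (h2 j)]
  · calc ∑ i, ∑ j, c i j * η i j
        ≤ ∑ i, ∑ j, (c i j * t i j + C * ((p i - ∑ j, t i j) * (q j - ∑ i, t i j) / m)) := by
          refine Finset.sum_le_sum fun i _ => Finset.sum_le_sum fun j _ => ?_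
          rw [hη, mul_add]
          gcongr
          exact hC i j
      _ = _ := by
          simp_rw [Finset.sum_add_distrib, ← Finset.mul_sum, hRS, hR]

lemma aux_floor (N : ℕ) (hN : N ≠ 0) (y : ℝ≥0∞) (hy : y ≤ 1) :
    ∃ k : Fin (N + 1), ((k : ℕ) : ℝ≥0∞) / N ≤ y ∧ y ≤ ((k : ℕ) : ℝ≥0∞) / N + 1 / N := by
  have hN' : (N : ℝ≥0∞) ≠ 0 := by exact_mod_cast hN
  have hNt : (N : ℝ≥0∞) ≠ ⊤ := ENNReal.natCast_ne_top N
  lift y to ℝ≥0 using ne_top_of_le_ne_top ENNReal.one_ne_top hy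
  have hy' : y ≤ 1 := by exact_mod_cast hy
  have hk : ⌊y * N⌋₊ < N + 1 := by
    rw [Nat.floor_lt (by positivity)]
    push_cast
    calc y * N ≤ 1 * N := by gcongr
      _ < N + 1 := by rw [one_mul]; exact lt_add_one _
  refine ⟨⟨⌊y * N⌋₊, hk⟩, ?_, ?_⟩
  · rw [ENNReal.div_le_iff hN' hNt]
    have := Nat.floor_le (a := y * N) (by positivity)
    exact_mod_cast this
  · rw [← ENNReal.add_div, ENNReal.le_div_iff_mul_le (Or.inl hN') (Or.inl hNt)]
    have := (Nat.lt_floor_add_one (y * N)).le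
    exact_mod_cast this

lemma aux_fin {Z F : Type*} [MeasurableSpace Z] [Fintype F] (p q : Z → F → ℝ≥0∞)
    (hp : ∀ i, Measurable fun z => p z i) (hq : ∀ i, Measurable fun z => q z i)
    (hp1 : ∀ z, ∑ i, p z i = 1) (hq1 : ∀ z, ∑ i, q z i = 1)
    (c : F → F → ℝ≥0) (ε : ℝ≥0∞) (hε : ε ≠ 0) :
    ∃ η : Z → F → F → ℝ≥0∞, (∀ i j, Measurable fun z => η z i j) ∧
      (∀ z i, ∑ j, η z i j = p z i) ∧ (∀ z j, ∑ i, η z i j = q z j) ∧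
      ∀ z (η' : F → F → ℝ≥0∞), (∀ i, ∑ j, η' i j = p z i) → (∀ j, ∑ i, η' i j = q z j) →
        ∑ i, ∑ j, (c i j : ℝ≥0∞) * η z i j ≤ ∑ i, ∑ j, (c i j : ℝ≥0∞) * η' i j + ε := by
  let C : ℝ≥0 := ∑ i, ∑ j, c i j
  have hC : ∀ i j, (c i j : ℝ≥0∞) ≤ C := fun i j => by
    have h1 : c i j ≤ ∑ j, c i j := Finset.single_le_sum (f := fun j => c i j)
      (fun _ _ => zero_le) (Finset.mem_univ j)
    have h2 : ∑ j, c i j ≤ C := Finset.single_le_sum (f := fun i => ∑ j, c i j)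
      (fun _ _ => zero_le) (Finset.mem_univ i)
    exact_mod_cast h1.trans h2
  obtain ⟨N, hN, hNε⟩ : ∃ N : ℕ, N ≠ 0 ∧
      (C : ℝ≥0∞) * (∑ _i : F, ∑ _j : F, 1 / (N : ℝ≥0∞)) ≤ ε := by
    let K : ℝ≥0∞ := C * (Fintype.card F * Fintype.card F)
    have hK : K ≠ ⊤ := ENNReal.mul_ne_top ENNReal.coe_ne_top
      (ENNReal.mul_ne_top (ENNReal.natCast_ne_top _) (ENNReal.natCast_ne_top _))
    obtain ⟨n, hn⟩ := ENNReal.exists_nat_gt (ENNReal.div_ne_top hK hε)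
    refine ⟨n + 1, by simp, ?_⟩
    simp only [Finset.sum_const, Finset.card_univ, nsmul_eq_mul]
    have : K ≤ (n + 1 : ℕ) * ε := by
      by_cases ht : ε = ⊤
      · rw [ht, ENNReal.mul_top (by simp)]; exact le_top
      rw [ENNReal.div_lt_iff (Or.inl hε) (Or.inl ht)] at hn
      refine hn.le.trans ?_
      gcongr
      simp
    calc (C : ℝ≥0∞) * (Fintype.card F * (Fintype.card F * (1 / ((n + 1 : ℕ) : ℝ≥0∞))))
        = K / (n + 1 : ℕ) := by simp only [K, div_eq_mul_inv, one_mul, mul_assoc]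
      _ ≤ ε := ENNReal.div_le_of_le_mul' this
  let v : (F → F → Fin (N + 1)) → F → F → ℝ≥0∞ := fun θ i j => ((θ i j : ℕ) : ℝ≥0∞) / N
  let J : (F → F → Fin (N + 1)) → ℝ≥0∞ := fun θ =>
    ∑ i, ∑ j, (c i j : ℝ≥0∞) * v θ i j + C * (1 - ∑ i, ∑ j, v θ i j)
  let Adm : Z → (F → F → Fin (N + 1)) → Prop := fun z θ =>
    (∀ i, ∑ j, v θ i j ≤ p z i) ∧ ∀ j, ∑ i, v θ i j ≤ q z j
  have hAdm : ∀ θ, MeasurableSet {z | Adm z θ} := fun θ => by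
    have h := (MeasurableSet.iInter fun i => measurableSet_le
      (measurable_const (a := ∑ j, v θ i j)) (hp i)).inter
      (MeasurableSet.iInter fun j => measurableSet_le
        (measurable_const (a := ∑ i, v θ i j)) (hq j))
    convert h using 1
    ext z
    simp [Adm]
  let _ : MeasurableSpace (F → F → Fin (N + 1)) := ⊤
  obtain ⟨s, hs, hsP⟩ := aux_select (fun z θ => Adm z θ ∧ ∀ θ', Adm z θ' → J θ ≤ J θ')
    (fun θ => by
      have : {z | Adm z θ ∧ ∀ θ', Adm z θ' → J θ ≤ J θ'}
        = {z | Adm z θ} ∩ ⋂ θ', ({z | Adm z θ'}ᶜ ∪ {_z | J θ ≤ J θ'}) := by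
        ext z
        simp [imp_iff_not_or]
      rw [this]
      exact (hAdm θ).inter (MeasurableSet.iInter fun θ' => (hAdm θ').compl.union
        (MeasurableSet.const _)))
    (fun z => by
      have hne : (Finset.univ.filter fun θ => Adm z θ).Nonempty :=
        ⟨fun _ _ => 0, by simp [Adm, v]⟩
      obtain ⟨θ, hθ, hmin⟩ := Finset.exists_min_image _ J hne
      exact ⟨θ, (Finset.mem_filter.1 hθ).2, fun θ' h' => hmin θ' (by simp [h'])⟩)
  let η : Z → F → F → ℝ≥0∞ := fun z i j => v (s z) i j +
    (p z i - ∑ j, v (s z) i j) * (q z j - ∑ i, v (s z) i j) / (1 - ∑ i, ∑ j, v (s z) i j)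
  have hvm : ∀ i j, Measurable fun z => v (s z) i j := fun i j =>
    (measurable_from_top (f := fun θ => v θ i j)).comp hs
  have hcomp := fun z => aux_complete (p z) (q z) (hp1 z) (hq1 z) (v (s z)) (hsP z).1.1
    (hsP z).1.2 (fun i j => c i j) C hC (η z) (fun i j => rfl)
  refine ⟨η, fun i j => ?_, fun z => (hcomp z).1, fun z => (hcomp z).2.1, fun z η' h1 h2 => ?_⟩
  · have m1 : Measurable fun z => ∑ j, v (s z) i j := Finset.measurable_fun_sum _ fun j _ => hvm i j
    have m2 : Measurable fun z => ∑ i, v (s z) i j := Finset.measurable_fun_sum _ fun i _ => hvm i j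
    have m3 : Measurable fun z => ∑ i, ∑ j, v (s z) i j :=
      Finset.measurable_fun_sum _ fun i _ => Finset.measurable_fun_sum _ fun j _ => hvm i j
    exact (hvm i j).add ((((hp i).sub m1).mul ((hq j).sub m2)).div (measurable_const.sub m3))
  · refine (hcomp z).2.2.trans ?_
    have hle1 : ∀ i j, η' i j ≤ 1 := fun i j => by
      calc η' i j ≤ ∑ j, η' i j := Finset.single_le_sum (f := fun j => η' i j)
            (fun _ _ => zero_le) (Finset.mem_univ j)
        _ = p z i := h1 i
        _ ≤ ∑ i, p z i := Finset.single_le_sum (fun _ _ => zero_le) (Finset.mem_univ i)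
        _ = 1 := hp1 z
    choose θ hθ1 hθ2 using fun i j => aux_floor N hN (η' i j) (hle1 i j)
    have hA : Adm z θ := ⟨fun i => (h1 i) ▸ Finset.sum_le_sum fun j _ => hθ1 i j,
      fun j => (h2 j) ▸ Finset.sum_le_sum fun i _ => hθ1 i j⟩
    refine ((hsP z).2 θ hA).trans ?_
    refine add_le_add ?_ ?_
    · gcongr with i _ j _
      exact hθ1 i j
    · refine le_trans ?_ hNε
      gcongr
      rw [tsub_le_iff_left]
      calc (1 : ℝ≥0∞) = ∑ i, ∑ j, η' i j := by rw [← hp1 z]; simp_rw [h1]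
        _ ≤ ∑ i, ∑ j, (v θ i j + 1 / (N : ℝ≥0∞)) :=
          Finset.sum_le_sum fun i _ => Finset.sum_le_sum fun j _ => hθ2 i j
        _ = _ := by simp_rw [Finset.sum_add_distrib]

lemma aux_lint {X F : Type*} [MeasurableSpace X] [Fintype F] [MeasurableSpace F]
    [DiscreteMeasurableSpace F] (μ : Measure X) (d : X → F) (hd : Measurable d) (h : F → ℝ≥0∞) :
    ∫⁻ x, h (d x) ∂μ = ∑ i, h i * μ (d ⁻¹' {i}) := by
  rw [← lintegral_map (Measurable.of_discrete (f := h)) hd, lintegral_fintype]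
  simp_rw [Measure.map_apply hd (MeasurableSet.of_discrete)]

lemma aux_marg {X F : Type*} [MeasurableSpace X] [Fintype F] [MeasurableSpace F]
    [DiscreteMeasurableSpace F] (μ ν : Measure X) [IsProbabilityMeasure μ] [IsProbabilityMeasure ν]
    (d : X → F) (hd : Measurable d) (η : F → F → ℝ≥0∞)
    (h1 : ∀ i, ∑ j, η i j = μ (d ⁻¹' {i})) (h2 : ∀ j, ∑ i, η i j = ν (d ⁻¹' {j}))
    (f : X → ℝ≥0∞) :
    ∫⁻ x, ∫⁻ x', η (d x) (d x') / (μ (d ⁻¹' {d x}) * ν (d ⁻¹' {d x'})) * f x ∂ν ∂μ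
      = ∫⁻ x, f x ∂μ := by
  have hae : ∀ᵐ x ∂μ, μ (d ⁻¹' {d x}) ≠ 0 := by
    have : ∀ i, ∀ᵐ x ∂μ, μ (d ⁻¹' {i}) = 0 → d x ≠ i := fun i => by
      by_cases h : μ (d ⁻¹' {i}) = 0
      · filter_upwards [measure_eq_zero_iff_ae_notMem.1 h] with x hx _ hxi
        exact hx hxi
      · exact Eventually.of_forall fun x hx => (h hx).elim
    filter_upwards [ae_all_iff.2 this] with x hx h0
    exact hx _ h0 rfl
  refine lintegral_congr_ae ?_
  filter_upwards [hae] with x hx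
  have := aux_lint ν d hd
    (fun j => η (d x) j / (μ (d ⁻¹' {d x}) * ν (d ⁻¹' {j})) * f x)
  rw [this]
  have hterm : ∀ j, η (d x) j / (μ (d ⁻¹' {d x}) * ν (d ⁻¹' {j})) * f x * ν (d ⁻¹' {j})
      = η (d x) j * ((μ (d ⁻¹' {d x}))⁻¹ * f x) := fun j => by
    by_cases h0 : ν (d ⁻¹' {j}) = 0
    · have : η (d x) j = 0 :=
        (Finset.sum_eq_zero_iff.1 ((h2 j).trans h0)) (d x) (Finset.mem_univ _)
      simp [this]
    · rw [div_eq_mul_inv, ENNReal.mul_inv (Or.inl hx) (Or.inl (measure_ne_top _ _))]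
      calc _ = η (d x) j * ((μ (d ⁻¹' {d x}))⁻¹ * f x)
            * ((ν (d ⁻¹' {j}))⁻¹ * ν (d ⁻¹' {j})) := by ring
        _ = _ := by rw [ENNReal.inv_mul_cancel h0 (measure_ne_top _ _), mul_one]
  simp_rw [hterm]
  rw [← Finset.sum_mul, h1, ← mul_assoc, ENNReal.mul_inv_cancel hx (measure_ne_top _ _), one_mul]

lemma aux_cost {X F : Type*} [MeasurableSpace X] [Fintype F] [MeasurableSpace F]
    [DiscreteMeasurableSpace F] (μ ν : Measure X) [IsProbabilityMeasure μ] [IsProbabilityMeasure ν]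
    (d : X → F) (hd : Measurable d) (η : F → F → ℝ≥0∞)
    (h1 : ∀ i, ∑ j, η i j = μ (d ⁻¹' {i})) (h2 : ∀ j, ∑ i, η i j = ν (d ⁻¹' {j}))
    (g : F → F → ℝ≥0∞) :
    ∫⁻ x, ∫⁻ x', η (d x) (d x') / (μ (d ⁻¹' {d x}) * ν (d ⁻¹' {d x'})) * g (d x) (d x') ∂ν ∂μ
      = ∑ i, ∑ j, g i j * η i j := by
  have e1 : ∀ x, ∫⁻ x', η (d x) (d x') / (μ (d ⁻¹' {d x}) * ν (d ⁻¹' {d x'}))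
      * g (d x) (d x') ∂ν = ∑ j, η (d x) j / (μ (d ⁻¹' {d x}) * ν (d ⁻¹' {j}))
      * g (d x) j * ν (d ⁻¹' {j}) := fun x =>
    aux_lint ν d hd (fun j => η (d x) j / (μ (d ⁻¹' {d x}) * ν (d ⁻¹' {j})) * g (d x) j)
  simp_rw [e1]
  rw [aux_lint μ d hd (fun i => ∑ j, η i j / (μ (d ⁻¹' {i}) * ν (d ⁻¹' {j}))
      * g i j * ν (d ⁻¹' {j}))]
  refine Finset.sum_congr rfl fun i _ => ?_
  rw [Finset.sum_mul]
  refine Finset.sum_congr rfl fun j _ => ?_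
  by_cases hi : μ (d ⁻¹' {i}) = 0
  · have : η i j = 0 := (Finset.sum_eq_zero_iff.1 ((h1 i).trans hi)) j (Finset.mem_univ _)
    simp [this]
  by_cases hj : ν (d ⁻¹' {j}) = 0
  · have : η i j = 0 := (Finset.sum_eq_zero_iff.1 ((h2 j).trans hj)) i (Finset.mem_univ _)
    simp [this]
  have hij := mul_ne_zero hi hj
  have hijt : μ (d ⁻¹' {i}) * ν (d ⁻¹' {j}) ≠ ⊤ :=
    ENNReal.mul_ne_top (measure_ne_top _ _) (measure_ne_top _ _)
  calc _ = g i j * (η i j / (μ (d ⁻¹' {i}) * ν (d ⁻¹' {j}))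
        * (μ (d ⁻¹' {i}) * ν (d ⁻¹' {j}))) := by ring
    _ = _ := by rw [ENNReal.div_mul_cancel hij hijt]

lemma aux_lift {Z X F : Type*} [MeasurableSpace Z] [MeasurableSpace X] [Fintype F]
    [MeasurableSpace F] [DiscreteMeasurableSpace F]
    (PZ : Measure Z) [IsProbabilityMeasure PZ]
    (κP κQ : Kernel Z X) [IsMarkovKernel κP] [IsMarkovKernel κQ]
    (d : X → F) (hd : Measurable d) (η : Z → F → F → ℝ≥0∞)
    (hη : ∀ i j, Measurable fun z => η z i j)
    (h1 : ∀ z i, ∑ j, η z i j = κP z (d ⁻¹' {i})) (h2 : ∀ z j, ∑ i, η z i j = κQ z (d ⁻¹' {j})) :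
    ∃ ρ : Measure (Z × X × X), ρ.map (fun w => (w.1, w.2.1)) = PZ.compProd κP ∧
      ρ.map (fun w => (w.1, w.2.2)) = PZ.compProd κQ ∧
      ∀ g : F → F → ℝ≥0∞, ∫⁻ w, g (d w.2.1) (d w.2.2) ∂ρ
        = ∫⁻ z, ∑ i, ∑ j, g i j * η z i j ∂PZ := by
  let D : Z × X × X → ℝ≥0∞ := fun w => η w.1 (d w.2.1) (d w.2.2) /
    (κP w.1 (d ⁻¹' {d w.2.1}) * κQ w.1 (d ⁻¹' {d w.2.2}))
  have hD : Measurable D := by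
    have hF : Measurable (fun w : Z × F × F => η w.1 w.2.1 w.2.2 /
        (κP w.1 (d ⁻¹' {w.2.1}) * κQ w.1 (d ⁻¹' {w.2.2}))) := by
      refine measurable_from_prod_countable_left fun ij => ?_
      have m1 : Measurable fun z => κP z (d ⁻¹' {ij.1}) :=
        κP.measurable_coe (hd (MeasurableSet.of_discrete))
      have m2 : Measurable fun z => κQ z (d ⁻¹' {ij.2}) :=
        κQ.measurable_coe (hd (MeasurableSet.of_discrete))
      exact (hη ij.1 ij.2).div (m1.mul m2)
    exact hF.comp (f := fun w : Z × X × X => (w.1, d w.2.1, d w.2.2)) (by fun_prop)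
  let ρ := (PZ.compProd (κP ×ₖ κQ)).withDensity D
  have key : ∀ f : Z × X × X → ℝ≥0∞, Measurable f → ∫⁻ w, f w ∂ρ
      = ∫⁻ z, ∫⁻ x, ∫⁻ x', D (z, x, x') * f (z, x, x') ∂κQ z ∂κP z ∂PZ := fun f hf => by
    have hDf : Measurable (D * f) := hD.mul hf
    rw [lintegral_withDensity_eq_lintegral_mul _ hD hf, Measure.lintegral_compProd hDf]
    refine lintegral_congr fun z => ?_
    rw [Kernel.prod_apply]
    exact lintegral_prod (fun b => (D * f) (z, b))
      (hDf.comp (measurable_prodMk_left (x := z))).aemeasurable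
  refine ⟨ρ, ?_, ?_, fun g => ?_⟩
  · refine Measure.ext_of_lintegral _ fun f hf => ?_
    rw [lintegral_map hf (by fun_prop), key _ (by fun_prop), Measure.lintegral_compProd hf]
    exact lintegral_congr fun z => aux_marg (κP z) (κQ z) d hd (η z) (h1 z) (h2 z)
      (fun x => f (z, x))
  · refine Measure.ext_of_lintegral _ fun f hf => ?_
    rw [lintegral_map hf (by fun_prop), key _ (by fun_prop), Measure.lintegral_compProd hf]
    refine lintegral_congr fun z => ?_
    rw [← aux_marg (κQ z) (κP z) d hd (fun i j => η z j i) (h2 z) (h1 z) (fun x => f (z, x)),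
      lintegral_lintegral_swap]
    · simp only [D, mul_comm (κQ z _)]
    · have hDf : Measurable fun w : Z × X × X => D w * f (w.1, w.2.2) := by fun_prop
      exact (hDf.comp (measurable_prodMk_left (x := z))).aemeasurable
  · have hg : Measurable fun w : Z × X × X => g (d w.2.1) (d w.2.2) :=
      (Measurable.of_discrete (f := fun ij : F × F => g ij.1 ij.2)).comp
        (f := fun w : Z × X × X => (d w.2.1, d w.2.2)) (by fun_prop)
    rw [key _ hg]
    exact lintegral_congr fun z => aux_cost (κP z) (κQ z) d hd (η z) (h1 z) (h2 z) g

lemma aux_ge {Z X : Type*}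
    [MeasurableSpace Z] [TopologicalSpace Z] [PolishSpace Z] [BorelSpace Z]
    [MeasurableSpace X] [TopologicalSpace X] [PolishSpace X] [BorelSpace X]
    (cX : X → X → ℝ≥0∞) (hcX : LowerSemicontinuous fun p : X × X => cX p.1 p.2)
    (PZ : Measure Z) [IsProbabilityMeasure PZ]
    (κP κQ : Kernel Z X) [IsMarkovKernel κP] [IsMarkovKernel κQ] :
    (∫⁻ z, otCost cX (κP z) (κQ z) ∂PZ)
      ≤ otCost (fun p q : Z × X => if p.1 = q.1 then cX p.2 q.2 else ⊤)
        (PZ.compProd κP) (PZ.compProd κQ) := by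
  have hNX : Nonempty X := by
    obtain ⟨z⟩ : Nonempty Z := PZ.nonempty_of_neZero
    exact (κP z).nonempty_of_neZero
  have hcm : Measurable fun p : X × X => cX p.1 p.2 := hcX.measurable
  refine le_iInf₂ fun π hπ => ?_
  obtain ⟨hπ1, hπ2⟩ := hπ
  by_cases hfin : ∫⁻ w, (if w.1.1 = w.2.1 then cX w.1.2 w.2.2 else ⊤) ∂π = ⊤
  · exact le_top.trans hfin.ge
  have hmeas : Measurable fun w : (Z × X) × (Z × X) =>
      (if w.1.1 = w.2.1 then cX w.1.2 w.2.2 else ⊤) := by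
    refine Measurable.ite (measurableSet_eq_fun (by fun_prop) (by fun_prop)) ?_ measurable_const
    exact hcm.comp (f := fun w : (Z × X) × (Z × X) => (w.1.2, w.2.2)) (by fun_prop)
  have hdiag : ∀ᵐ w ∂π, w.1.1 = w.2.1 := by
    filter_upwards [ae_lt_top hmeas hfin] with w hw
    by_contra h
    simp [h] at hw
  have hprob : IsProbabilityMeasure π := by
    constructor
    have := congrArg (fun m => m Set.univ) hπ1
    simpa [Measure.map_apply measurable_fst MeasurableSet.univ] using this
  have hT : Measurable fun w : (Z × X) × (Z × X) => (w.1.1, (w.1.2, w.2.2)) := by fun_prop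
  let ρ : Measure (Z × X × X) := π.map fun w => (w.1.1, (w.1.2, w.2.2))
  have hρp : IsProbabilityMeasure ρ := Measure.isProbabilityMeasure_map hT.aemeasurable
  have hρ1 : ρ.map (fun w => (w.1, w.2.1)) = PZ.compProd κP := by
    rw [← hπ1, Measure.map_map (by fun_prop) hT]; rfl
  have hρ2 : ρ.map (fun w => (w.1, w.2.2)) = PZ.compProd κQ := by
    rw [← hπ2, Measure.map_map (by fun_prop) hT]
    refine Measure.map_congr ?_
    filter_upwards [hdiag] with w hw
    exact Prod.ext hw rfl
  have hρf : ρ.fst = PZ := by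
    have h : (ρ.map (fun w => (w.1, w.2.1))).fst = ρ.fst := by
      rw [Measure.fst, Measure.fst, Measure.map_map measurable_fst (by fun_prop)]
      rfl
    rw [← h, hρ1, Measure.fst_compProd]
  let κ := ρ.condKernel
  have hdis : PZ.compProd κ = ρ := by
    have := ρ.disintegrate ρ.condKernel
    rwa [hρf] at this
  have hmap : ∀ (s : X × X → X) (hs : Measurable s) (κ' : Kernel Z X) [IsMarkovKernel κ'],
      ρ.map (fun w => (w.1, s w.2)) = PZ.compProd κ' → ∀ᵐ z ∂PZ, (κ z).map s = κ' z := by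
    intro s hs κ' _ h
    have hMk : IsMarkovKernel (κ.map s) := Kernel.IsMarkovKernel.map _ hs
    have : PZ.compProd (κ.map s) = PZ.compProd κ' := by
      rw [← h, ← hdis]
      refine Measure.ext_of_lintegral _ fun f hf => ?_
      rw [lintegral_map hf (by fun_prop), Measure.lintegral_compProd hf,
        Measure.lintegral_compProd (by fun_prop)]
      refine lintegral_congr fun z => ?_
      rw [Kernel.map_apply _ hs, lintegral_map (by fun_prop) hs]
    have e1 := eq_condKernel_of_measure_eq_compProd (ρ := PZ.compProd κ') (κ.map s)
      (by rw [Measure.fst_compProd]; exact this.symm)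
    rw [Measure.fst_compProd] at e1
    have e2 := condKernel_compProd PZ κ'
    filter_upwards [e1, e2] with z h1 h2
    rw [← h2, ← h1, Kernel.map_apply _ hs]
  calc ∫⁻ z, otCost cX (κP z) (κQ z) ∂PZ ≤ ∫⁻ z, ∫⁻ p, cX p.1 p.2 ∂κ z ∂PZ := by
        refine lintegral_mono_ae ?_
        filter_upwards [hmap Prod.fst measurable_fst κP hρ1,
          hmap Prod.snd measurable_snd κQ hρ2] with z h1 h2
        exact iInf₂_le (κ z) ⟨h1, h2⟩
    _ = ∫⁻ w, cX w.2.1 w.2.2 ∂ρ := by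
        rw [← hdis, Measure.lintegral_compProd (f := fun w : Z × X × X => cX w.2.1 w.2.2)
          (hcm.comp measurable_snd)]
    _ = ∫⁻ w, cX w.1.2 w.2.2 ∂π := by
        exact lintegral_map (f := fun w : Z × X × X => cX w.2.1 w.2.2) (hcm.comp measurable_snd) hT
    _ ≤ _ := by
        refine lintegral_mono fun w => ?_
        dsimp only
        split_ifs
        · exact le_rfl
        · exact le_top

lemma aux_le {Z X : Type*}
    [MeasurableSpace Z] [TopologicalSpace Z] [PolishSpace Z] [BorelSpace Z]
    [MeasurableSpace X] [TopologicalSpace X] [PolishSpace X] [BorelSpace X]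
    (cX : X → X → ℝ≥0∞) (hcX : LowerSemicontinuous fun p : X × X => cX p.1 p.2)
    (PZ : Measure Z) [IsProbabilityMeasure PZ]
    (κP κQ : Kernel Z X) [IsMarkovKernel κP] [IsMarkovKernel κQ] :
    otCost (fun p q : Z × X => if p.1 = q.1 then cX p.2 q.2 else ⊤)
        (PZ.compProd κP) (PZ.compProd κQ) ≤ ∫⁻ z, otCost cX (κP z) (κQ z) ∂PZ := by
  obtain ⟨a, U, V, hU, hV, hc⟩ := aux_lsc cX hcX
  let T : ℕ → X → X → ℝ≥0 := fun k x x' => if x ∈ U k ∧ x' ∈ V k then a k else 0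
  let cn : ℕ → X → X → ℝ≥0 := fun n x x' => Finset.univ.sup fun k : Fin n => T k x x'
  have hTc : ∀ k x x', (T k x x' : ℝ≥0∞) ≤ cX x x' := fun k x x' => by
    rw [hc]
    refine le_iSup_of_le k ?_
    simp only [T]
    split_ifs <;> simp
  have hcn_le : ∀ n x x', (cn n x x' : ℝ≥0∞) ≤ cX x x' := fun n x x' => by
    rcases Nat.eq_zero_or_pos n with rfl | hn
    · simp [cn]
    have : Nonempty (Fin n) := ⟨⟨0, hn⟩⟩
    obtain ⟨k, -, hk⟩ := Finset.exists_mem_eq_sup Finset.univ Finset.univ_nonempty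
      (fun k : Fin n => T k x x')
    simp only [cn, hk]
    exact hTc k x x'
  have hcn_mono : ∀ x x', Monotone fun n => cn n x x' := fun x x' n m hnm =>
    Finset.sup_le fun k _ => Finset.le_sup (f := fun k : Fin m => T k x x')
      (Finset.mem_univ (Fin.castLE hnm k))
  have hcn_sup : ∀ x x', cX x x' ≤ ⨆ n, (cn n x x' : ℝ≥0∞) := fun x x' => by
    rw [hc]
    refine iSup_le fun k => le_iSup_of_le (k + 1) ?_
    have h1 : T k x x' ≤ cn (k + 1) x x' :=
      Finset.le_sup (f := fun j : Fin (k + 1) => T j x x') (Finset.mem_univ (Fin.last k))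
    refine le_trans (le_of_eq ?_) (ENNReal.coe_le_coe.2 h1)
    simp only [T]
    split_ifs <;> simp
  have hcn_lsc : ∀ n, LowerSemicontinuous fun w : Z × X × X => (cn n w.2.1 w.2.2 : ℝ) := by
    intro n w y hy
    rcases lt_or_ge y 0 with h0 | h0
    · exact Eventually.of_forall fun w' => h0.trans_le (NNReal.coe_nonneg _)
    lift y to ℝ≥0 using h0
    have hy' : y < cn n w.2.1 w.2.2 := by exact_mod_cast hy
    obtain ⟨k, -, hk⟩ := Finset.lt_sup_iff.1 hy'
    by_cases hw : w.2.1 ∈ U k ∧ w.2.2 ∈ V k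
    · have hop : IsOpen {w : Z × X × X | w.2.1 ∈ U k ∧ w.2.2 ∈ V k} :=
        ((hU k).preimage (by fun_prop : Continuous fun w : Z × X × X => w.2.1)).inter
          ((hV k).preimage (by fun_prop : Continuous fun w : Z × X × X => w.2.2))
      filter_upwards [hop.mem_nhds hw] with w' hw'
      have h1 : T k w'.2.1 w'.2.2 ≤ cn n w'.2.1 w'.2.2 :=
        Finset.le_sup (f := fun j : Fin n => T j w'.2.1 w'.2.2) (Finset.mem_univ k)
      have h2 : T k w'.2.1 w'.2.2 = T k w.2.1 w.2.2 := by
        have hw'' : w'.2.1 ∈ U k ∧ w'.2.2 ∈ V k := hw'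
        simp only [T, if_pos hw, if_pos hw'']
      have h3 := (hk.trans_eq h2.symm).trans_le h1
      exact_mod_cast h3
    · simp [T, if_neg hw] at hk
  have step : ∀ n : ℕ, ∃ ρ : Measure (Z × X × X),
      ρ.map (fun w => (w.1, w.2.1)) = PZ.compProd κP ∧
      ρ.map (fun w => (w.1, w.2.2)) = PZ.compProd κQ ∧
      ∫⁻ w, cn n w.2.1 w.2.2 ∂ρ ≤ ∫⁻ z, otCost cX (κP z) (κQ z) ∂PZ + (n + 1 : ℝ≥0∞)⁻¹ := by
    intro n
    let d : X → (Fin n → Bool × Bool) := fun x k => (decide (x ∈ U k), decide (x ∈ V k))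
    have hd : Measurable d := by
      refine measurable_pi_lambda _ fun k => ?_
      refine Measurable.prodMk ?_ ?_
      · exact measurable_to_bool (by
          convert (hU k).measurableSet using 1
          ext x
          simp)
      · exact measurable_to_bool (by
          convert (hV k).measurableSet using 1
          ext x
          simp)
    let c' : (Fin n → Bool × Bool) → (Fin n → Bool × Bool) → ℝ≥0 := fun f g =>
      Finset.univ.sup fun k : Fin n => if (f k).1 = true ∧ (g k).2 = true then a k else 0
    have hc' : ∀ x x', c' (d x) (d x') = cn n x x' := fun x x' => by
      simp [c', d, cn, T]
    have hsum : ∀ (κ : Kernel Z X) [IsMarkovKernel κ] (z : Z), ∑ i, κ z (d ⁻¹' {i}) = 1 := by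
      intro κ _ z
      have := aux_lint (κ z) d hd (fun _ => 1)
      simpa using this.symm
    obtain ⟨η, hη, h1, h2, hopt⟩ := aux_fin (fun z i => κP z (d ⁻¹' {i}))
      (fun z i => κQ z (d ⁻¹' {i})) (fun i => κP.measurable_coe (hd (MeasurableSet.of_discrete)))
      (fun i => κQ.measurable_coe (hd (MeasurableSet.of_discrete))) (hsum κP) (hsum κQ) c'
      (n + 1 : ℝ≥0∞)⁻¹ (ENNReal.inv_ne_zero.2 (by finiteness))
    obtain ⟨ρ, hρ1, hρ2, hρ3⟩ := aux_lift PZ κP κQ d hd η hη h1 h2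
    refine ⟨ρ, hρ1, hρ2, ?_⟩
    have h3 := hρ3 (fun i j => c' i j)
    simp only [hc'] at h3
    rw [h3]
    calc ∫⁻ z, ∑ i, ∑ j, (c' i j : ℝ≥0∞) * η z i j ∂PZ
        ≤ ∫⁻ z, (otCost cX (κP z) (κQ z) + (n + 1 : ℝ≥0∞)⁻¹) ∂PZ := by
          refine lintegral_mono fun z => ?_
          refine le_trans ?_ (add_le_add_left (le_iInf₂ (a := ⨅ π ∈ {π : Measure (X × X) |
            π.map Prod.fst = κP z ∧ π.map Prod.snd = κQ z}, ∫⁻ p, cn n p.1 p.2 ∂π)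
            fun π hπ => (iInf₂_le π hπ).trans (lintegral_mono fun p => hcn_le n p.1 p.2)) _)
          rw [ENNReal.iInf_add]
          refine le_iInf fun π => ?_
          by_cases hπ : π ∈ {π : Measure (X × X) |
            π.map Prod.fst = κP z ∧ π.map Prod.snd = κQ z}
          swap
          · simp [hπ]
          simp only [hπ, iInf_pos]
          have hdd : Measurable fun p : X × X => (d p.1, d p.2) := by fun_prop
          have hfst : ∀ i, ∑ j, π ((fun p : X × X => (d p.1, d p.2)) ⁻¹' {(i, j)})
              = κP z (d ⁻¹' {i}) := fun i => by
            rw [← hπ.1, Measure.map_apply measurable_fst (hd (MeasurableSet.of_discrete))]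
            rw [← measure_biUnion_finset]
            · congr 1
              ext p
              simp
            · intro j _ j' _ hjj
              refine Disjoint.preimage _ ?_
              simpa using hjj
            · exact fun j _ => hdd (MeasurableSet.of_discrete)
          have hsnd : ∀ j, ∑ i, π ((fun p : X × X => (d p.1, d p.2)) ⁻¹' {(i, j)})
              = κQ z (d ⁻¹' {j}) := fun j => by
            rw [← hπ.2, Measure.map_apply measurable_snd (hd (MeasurableSet.of_discrete))]
            rw [← measure_biUnion_finset]
            · congr 1
              ext p
              simp
            · intro j _ j' _ hjj
              refine Disjoint.preimage _ ?_
              simpa using hjj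
            · exact fun j _ => hdd (MeasurableSet.of_discrete)
          refine (hopt z _ hfst hsnd).trans (le_of_eq ?_)
          congr 1
          have := aux_lint π (fun p : X × X => (d p.1, d p.2)) hdd (fun ij => (c' ij.1 ij.2 : ℝ≥0∞))
          simp only [hc'] at this
          rw [this, Fintype.sum_prod_type]
      _ = _ := by
          rw [lintegral_add_right _ measurable_const]
          simp
  choose ρ hρ1 hρ2 hρ3 using step
  obtain ⟨μ, φ, hφ, hμ1, hμ2, hμo⟩ := aux_compact (PZ.compProd κP) (PZ.compProd κQ) ρ hρ1 hρ2
  set I := ∫⁻ z, otCost cX (κP z) (κQ z) ∂PZ with hI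
  have hcnm : ∀ n, Measurable fun w : Z × X × X => (cn n w.2.1 w.2.2 : ℝ≥0∞) := fun n => by
    have := ((hcn_lsc n).measurable).ennreal_ofReal
    simpa using this
  have hlim : ∀ m, ∫⁻ w, cn m w.2.1 w.2.2 ∂μ ≤ I := fun m => by
    have h := aux_liminf (hcn_lsc m) (fun w => NNReal.coe_nonneg _) hμo
    simp only [ENNReal.ofReal_coe_nnreal] at h
    refine h.trans ?_
    have htend : Tendsto (fun i : ℕ => I + ((φ i : ℕ) + 1 : ℝ≥0∞)⁻¹) atTop (𝓝 (I + 0)) := by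
      refine Tendsto.const_add _ ?_
      have h1 : Tendsto (fun n : ℕ => (((n + 1 : ℕ) : ℝ≥0∞))⁻¹) atTop (𝓝 0) :=
        ENNReal.tendsto_inv_nat_nhds_zero.comp (tendsto_add_atTop_nat 1)
      have h2 := h1.comp hφ.tendsto_atTop
      refine h2.congr fun i => ?_
      simp
    rw [add_zero] at htend
    rw [← htend.liminf_eq]
    refine liminf_le_liminf ?_
    filter_upwards [hφ.tendsto_atTop.eventually_ge_atTop m] with i hi
    refine le_trans ?_ (hρ3 (φ i))
    exact lintegral_mono fun w => ENNReal.coe_le_coe.2 (hcn_mono _ _ hi)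
  have hfinal : ∫⁻ w, cX w.2.1 w.2.2 ∂μ ≤ I := by
    calc ∫⁻ w, cX w.2.1 w.2.2 ∂μ ≤ ∫⁻ w, ⨆ n, (cn n w.2.1 w.2.2 : ℝ≥0∞) ∂μ :=
          lintegral_mono fun w => hcn_sup _ _
      _ = ⨆ n, ∫⁻ w, cn n w.2.1 w.2.2 ∂μ := lintegral_iSup hcnm
          fun n m hnm w => ENNReal.coe_le_coe.2 (hcn_mono _ _ hnm)
      _ ≤ I := iSup_le hlim
  have hG : Measurable fun w : Z × X × X => ((w.1, w.2.1), (w.1, w.2.2)) := by fun_prop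
  refine (iInf₂_le (μ.map fun w : Z × X × X => ((w.1, w.2.1), (w.1, w.2.2))) ⟨?_, ?_⟩).trans ?_
  · refine (lintegral_map_le _ _).trans (le_trans (le_of_eq ?_) hfinal)
    simp
  · rw [Measure.map_map measurable_fst hG, ← hμ1]; rfl
  · rw [Measure.map_map measurable_snd hG, ← hμ2]; rfl

/-- converse disintegration inequality: for measures `P_{Z,X}` and `Q_{Z,X}` on
`Z × X` with common `Z`-marginal `P_Z` and disintegrations `κP`, `κQ`,
`W_{c̃}(P_{Z,X}, Q_{Z,X}) ≥ ∫ W_{c_X}(P_{X|Z=z}, Q_{X|Z=z}) P_Z(dz)`; hence the joint OT cost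
with the diagonal-restricted cost `c̃` equals the averaged conditional OT cost, `c̃` being the
diagonal-restricted cost. -/
theorem restricted_otCost_ge_and_eq_integral_conditional_otCost
    {Z X : Type*}
    [MeasurableSpace Z] [TopologicalSpace Z] [PolishSpace Z] [BorelSpace Z]
    [MeasurableSpace X] [TopologicalSpace X] [PolishSpace X] [BorelSpace X]
    (cX : X → X → ℝ≥0∞) (hcXfin : ∀ x x', cX x x' < ⊤)
    (hcX : LowerSemicontinuous fun p : X × X => cX p.1 p.2)
    (PZ : Measure Z) [IsProbabilityMeasure PZ]
    (PZX QZX : Measure (Z × X)) [IsProbabilityMeasure PZX] [IsProbabilityMeasure QZX]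
    (κP κQ : Kernel Z X) [IsMarkovKernel κP] [IsMarkovKernel κQ]
    (hdisP : PZX = PZ.compProd κP) (hdisQ : QZX = PZ.compProd κQ) :
    (∫⁻ z, otCost cX (κP z) (κQ z) ∂PZ)
      ≤ otCost (fun p q : Z × X => if p.1 = q.1 then cX p.2 q.2 else ⊤) PZX QZX
    ∧ otCost (fun p q : Z × X => if p.1 = q.1 then cX p.2 q.2 else ⊤) PZX QZX
      = ∫⁻ z, otCost cX (κP z) (κQ z) ∂PZ := by
  subst hdisP hdisQ
  have h1 := aux_ge cX hcX PZ κP κQ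
  exact ⟨h1, le_antisymm (aux_le cX hcX PZ κP κQ) h1⟩
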